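/- arXiv:2110.04087 — 13 statements merged into one kernel-verified Lean document; each statement's English description precedes it below -/
import Mathlib

section
/- Let ξ ∈ {1, −1}, let I ⊆ (0,∞) be an open interval, let A : I → ℝ be twice differentiable and everywhere positive, set B = 1/A, let F : I → ℝ be differentiable with F(r) ≠ 0 for all r ∈ I, and let 𝔣 : I → ℝ. Assume the real-tetrad vacuum f(T) field equations (R1), (R2), (R3) hold at every r ∈ I, and if ξ = 1 assume additionally that A(r) ≠ 1 for all r ∈ I. Then F is constant on I, and there exist constants M, Λ ∈ ℝ such that A(r)² = 1 − 2M/r − (Λ/3)r² for all r ∈ I. (Thus with g_rr = −1/g_tt the only possibility is f_T constant, i.e. TEGR plus a cosmological constant, and the geometry is Schwarzschild–de Sitter.) -/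
theorem exists_eq_const_of_hasDerivAt_zero {p q : ℝ} {f : ℝ → ℝ}
    (hf : ∀ r ∈ Set.Ioo p q, HasDerivAt f 0 r) : ∃ C, ∀ r ∈ Set.Ioo p q, f r = C :=
  isOpen_Ioo.exists_is_const_of_deriv_eq_zero isPreconnected_Ioo
    (fun r hr => (hf r hr).differentiableAt.differentiableWithinAt)
    (fun r hr => (hf r hr).deriv)

/-- Solutions of the Euler equation `r² h'' = 2 h` on an interval of positive reals are spanned by
`r²` and `1 / r`. -/
theorem exists_eq_of_euler_equation {p q : ℝ} (hpos : Set.Ioo p q ⊆ Set.Ioi (0 : ℝ))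
    {h h' h'' : ℝ → ℝ} (hh : ∀ r ∈ Set.Ioo p q, HasDerivAt h (h' r) r)
    (hh' : ∀ r ∈ Set.Ioo p q, HasDerivAt h' (h'' r) r)
    (euler : ∀ r ∈ Set.Ioo p q, r ^ 2 * h'' r = 2 * h r) :
    ∃ a b : ℝ, ∀ r ∈ Set.Ioo p q, h r = a * r ^ 2 + b / r := by
  obtain ⟨a, ha⟩ : ∃ a, ∀ r ∈ Set.Ioo p q, (r * h' r + h r) / r ^ 2 = a := by
    refine exists_eq_const_of_hasDerivAt_zero fun r hr => ?_
    have hr0 : r ≠ 0 := (hpos hr).ne'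
    refine ((((hasDerivAt_id' r).fun_mul (hh' r hr)).fun_add (hh r hr)).fun_div (hasDerivAt_pow 2 r)
      (pow_ne_zero 2 hr0)).congr_deriv ?_
    field_simp
    linear_combination r * euler r hr
  obtain ⟨b, hb⟩ : ∃ b, ∀ r ∈ Set.Ioo p q, r * h r - a / 3 * r ^ 3 = b := by
    refine exists_eq_const_of_hasDerivAt_zero fun r hr => ?_
    have hr0 : r ≠ 0 := (hpos hr).ne'
    refine (((hasDerivAt_id' r).fun_mul (hh r hr)).fun_sub
      ((hasDerivAt_pow 3 r).const_mul (a / 3))).congr_deriv ?_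
    have := ha r hr
    rw [div_eq_iff (pow_ne_zero 2 hr0)] at this
    push_cast
    linear_combination this
  refine ⟨a / 3, b, fun r hr => ?_⟩
  have hr0 : r ≠ 0 := (hpos hr).ne'
  rw [← hb r hr]
  field_simp
  ring


/-- In `f(T)` gravity with the real spherically symmetric tetrad (branch `ξ = ±1`) and
`B = 1/A`, if the vacuum field equations (R1)–(R3) hold on an open interval `I ⊆ (0,∞)`
(with `A ≠ 1` in the `ξ = 1` branch), then `f_T` is constant and the metric is
Schwarzschild–de Sitter: `A² = 1 − 2M/r − (Λ/3)r²`. -/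
theorem real_tetrad_fT_schwarzschild_like_is_SdS
    (ξ : ℝ) (hξ : ξ = 1 ∨ ξ = -1)
    (I : Set ℝ) (hI : ∃ p q : ℝ, I = Set.Ioo p q) (hIpos : I ⊆ Set.Ioi (0 : ℝ))
    (A F 𝔣 : ℝ → ℝ)
    (hAdiff : ∀ r ∈ I, DifferentiableAt ℝ A r)
    (hAdiff2 : ∀ r ∈ I, DifferentiableAt ℝ (deriv A) r)
    (hApos : ∀ r ∈ I, 0 < A r)
    (B : ℝ → ℝ) (hB : ∀ r, B r = 1 / A r)
    (hFdiff : ∀ r ∈ I, DifferentiableAt ℝ F r)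
    (hFne : ∀ r ∈ I, F r ≠ 0)
    (hA1 : ξ = 1 → ∀ r ∈ I, A r ≠ 1)
    (hR1 : ∀ r ∈ I,
      -𝔣 r / 2
        - 2 * F r * (r * B r * deriv A r * (ξ * B r - 1)
            + A r * (r * deriv B r + ξ * (B r) ^ 2 - B r)) / (r ^ 2 * A r * (B r) ^ 3)
        + (2 - 2 * ξ * B r) * deriv F r / (r * (B r) ^ 2) = 0)
    (hR2 : ∀ r ∈ I,
      𝔣 r / 2
        + F r * (2 * r * deriv A r * (B r - 2 * ξ) - 2 * A r * (ξ - B r))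
            / (ξ * r ^ 2 * A r * (B r) ^ 2) = 0)
    (hR3 : ∀ r ∈ I,
      𝔣 r / 2
        + F r * (r * (r * deriv A r * deriv B r + 2 * ξ * (B r) ^ 2 * deriv A r
              - B r * (r * deriv (deriv A) r + 3 * deriv A r))
            - A r * (-(r * deriv B r) - 2 * ξ * (B r) ^ 2 + (B r) ^ 3 + B r))
            / (r ^ 2 * A r * (B r) ^ 3)
        - deriv F r * (r * deriv A r - ξ * A r * B r + A r) / (r * A r * (B r) ^ 2) = 0) :
    (∃ C : ℝ, ∀ r ∈ I, F r = C) ∧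
      ∃ M Λ : ℝ, ∀ r ∈ I, (A r) ^ 2 = 1 - 2 * M / r - (Λ / 3) * r ^ 2 := by
  obtain ⟨p, q, rfl⟩ := hI
  have hξ2 : ξ ^ 2 = 1 := by rcases hξ with rfl | rfl <;> norm_num
  have hξ0 : ξ ≠ 0 := by rintro rfl; norm_num at hξ2
  have hAξ : ∀ r ∈ Set.Ioo p q, A r - ξ ≠ 0 := by
    intro r hr h
    rcases hξ with rfl | rfl
    · exact hA1 rfl r hr (by linarith)
    · linarith [hApos r hr]
  have hB' : ∀ r ∈ Set.Ioo p q, deriv B r = -deriv A r / A r ^ 2 := by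
    intro r hr
    rw [show B = A⁻¹ from funext fun x => by simp [hB x]]
    exact ((hAdiff r hr).hasDerivAt.inv (hApos r hr).ne').deriv
  have R2 : ∀ r ∈ Set.Ioo p q, 𝔣 r / 2 + 2 * F r / r ^ 2 *
      (ξ * r * deriv A r - 2 * r * A r * deriv A r + ξ * A r - A r ^ 2) = 0 := by
    intro r hr
    have hr0 : r ≠ 0 := (hIpos hr).ne'
    have hA0 := (hApos r hr).ne'
    rw [← hR2 r hr, hB r]
    field_simp
    linear_combination (4 * F r * (r * deriv A r + A r)) * hξ2
  have hF' : ∀ r ∈ Set.Ioo p q, deriv F r = 0 := by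
    intro r hr
    have hr0 : r ≠ 0 := (hIpos hr).ne'
    have hA0 := (hApos r hr).ne'
    have R1 : -𝔣 r / 2 - 2 * F r / r ^ 2 *
        (ξ * r * deriv A r - 2 * r * A r * deriv A r + ξ * A r - A r ^ 2)
        + 2 * A r * (A r - ξ) / r * deriv F r = 0 := by
      rw [← hR1 r hr, hB' r hr, hB r]
      field_simp
      ring
    have hmul : 2 * A r * (A r - ξ) / r * deriv F r = 0 := by
      linear_combination R1 + R2 r hr
    exact (mul_eq_zero.1 hmul).resolve_left
      (div_ne_zero (mul_ne_zero (mul_ne_zero two_ne_zero hA0) (hAξ r hr)) hr0)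
  have euler : ∀ r ∈ Set.Ioo p q,
      r ^ 2 * (2 * (deriv A r ^ 2 + A r * deriv (deriv A) r)) = 2 * (A r ^ 2 - 1) := by
    intro r hr
    have hr0 : r ≠ 0 := (hIpos hr).ne'
    have hA0 := (hApos r hr).ne'
    have R3 : 𝔣 r / 2 + F r / r ^ 2 * (-r ^ 2 * deriv A r ^ 2 + 2 * ξ * r * deriv A r
        - r ^ 2 * A r * deriv (deriv A) r - 4 * r * A r * deriv A r
        + 2 * ξ * A r - 1 - A r ^ 2) = 0 := by
      rw [← hR3 r hr, hF' r hr, hB' r hr, hB r]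
      field_simp
      ring
    have hmul : F r / r ^ 2 *
        (A r ^ 2 - 1 - r ^ 2 * (deriv A r ^ 2 + A r * deriv (deriv A) r)) = 0 := by
      linear_combination R3 - R2 r hr
    have := (mul_eq_zero.1 hmul).resolve_left (div_ne_zero (hFne r hr) (pow_ne_zero 2 hr0))
    linear_combination (-2 : ℝ) * this
  refine ⟨exists_eq_const_of_hasDerivAt_zero fun r hr => hF' r hr ▸ (hFdiff r hr).hasDerivAt, ?_⟩
  obtain ⟨a, b, hab⟩ := exists_eq_of_euler_equation hIpos (h := fun r => A r ^ 2 - 1)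
    (h' := fun r => 2 * (A r * deriv A r))
    (h'' := fun r => 2 * (deriv A r ^ 2 + A r * deriv (deriv A) r))
    (fun r hr => by
      refine (((hAdiff r hr).hasDerivAt.fun_pow 2).sub_const 1).congr_deriv ?_
      push_cast
      ring)
    (fun r hr => by
      refine (((hAdiff r hr).hasDerivAt.fun_mul
        (hAdiff2 r hr).hasDerivAt).const_mul 2).congr_deriv ?_
      ring)
    euler
  refine ⟨-b / 2, -3 * a, fun r hr => ?_⟩
  linear_combination hab r hr
end

section
/- Let ξ ∈ {1, −1}, let I ⊆ (0,∞) be an open interval, let A : I → ℝ be twice differentiable and positive, B : I → ℝ differentiable and positive, F : I → ℝ differentiable with F(r) ≠ 0 for all r ∈ I, and 𝔣 : I → ℝ. If the real-tetrad vacuum f(T) field equations (R1), (R2), (R3) hold at every r ∈ I, then for all r ∈ I the f-independent relation A(r²(A'B' − BA'') + A(B − B³)) + ξ(r²AA'' + r²(A')² + A²(B² − 1)) = 0 holds. -/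
/-- In `f(T)` gravity with the real spherically symmetric tetrad, the vacuum field
equations (R1)–(R3) imply the `f`-independent relation
`A(r²(A'B' − BA'') + A(B − B³)) + ξ(r²AA'' + r²A'² + A²(B² − 1)) = 0`. -/
theorem real_tetrad_fT_f_independent_relation
    (ξ : ℝ) (hξ : ξ = 1 ∨ ξ = -1)
    (I : Set ℝ) (hI : ∃ p q : ℝ, I = Set.Ioo p q) (hIpos : I ⊆ Set.Ioi (0 : ℝ))
    (A B F 𝔣 : ℝ → ℝ)
    (hAdiff : ∀ r ∈ I, DifferentiableAt ℝ A r)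
    (hAdiff2 : ∀ r ∈ I, DifferentiableAt ℝ (deriv A) r)
    (hApos : ∀ r ∈ I, 0 < A r)
    (hBdiff : ∀ r ∈ I, DifferentiableAt ℝ B r)
    (hBpos : ∀ r ∈ I, 0 < B r)
    (hFdiff : ∀ r ∈ I, DifferentiableAt ℝ F r)
    (hFne : ∀ r ∈ I, F r ≠ 0)
    (hR1 : ∀ r ∈ I,
      -𝔣 r / 2
        - 2 * F r * (r * B r * deriv A r * (ξ * B r - 1)
            + A r * (r * deriv B r + ξ * (B r) ^ 2 - B r)) / (r ^ 2 * A r * (B r) ^ 3)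
        + (2 - 2 * ξ * B r) * deriv F r / (r * (B r) ^ 2) = 0)
    (hR2 : ∀ r ∈ I,
      𝔣 r / 2
        + F r * (2 * r * deriv A r * (B r - 2 * ξ) - 2 * A r * (ξ - B r))
            / (ξ * r ^ 2 * A r * (B r) ^ 2) = 0)
    (hR3 : ∀ r ∈ I,
      𝔣 r / 2
        + F r * (r * (r * deriv A r * deriv B r + 2 * ξ * (B r) ^ 2 * deriv A r
              - B r * (r * deriv (deriv A) r + 3 * deriv A r))
            - A r * (-(r * deriv B r) - 2 * ξ * (B r) ^ 2 + (B r) ^ 3 + B r))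
            / (r ^ 2 * A r * (B r) ^ 3)
        - deriv F r * (r * deriv A r - ξ * A r * B r + A r) / (r * A r * (B r) ^ 2) = 0) :
    ∀ r ∈ I,
      A r * (r ^ 2 * (deriv A r * deriv B r - B r * deriv (deriv A) r)
          + A r * (B r - (B r) ^ 3))
        + ξ * (r ^ 2 * A r * deriv (deriv A) r + r ^ 2 * (deriv A r) ^ 2
          + (A r) ^ 2 * ((B r) ^ 2 - 1)) = 0 := by
  intro r hr
  have hr0 : r ≠ 0 := (hIpos hr).ne'
  have hA0 : A r ≠ 0 := (hApos r hr).ne'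
  have hB0 : B r ≠ 0 := (hBpos r hr).ne'
  have hF0 : F r ≠ 0 := hFne r hr
  have h1 := hR1 r hr
  have h2 := hR2 r hr
  have h3 := hR3 r hr
  generalize deriv (deriv A) r = a₂ at *
  generalize deriv A r = a₁ at *
  generalize deriv B r = b₁ at *
  generalize deriv F r = f₁ at *
  generalize A r = a at *
  generalize B r = b at *
  generalize F r = f at *
  generalize 𝔣 r = g at *
  -- Both combinations eliminate `𝔣`: the first is (R1) + (R2), the second (R3) - (R2).
  have e₁ : f * (b * a₁ + a * b₁) = (1 - ξ * b) * a * b * f₁ := by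
    have h := congrArg₂ (· + ·) h1 h2
    rcases hξ with rfl | rfl
    all_goals
      field_simp at h
      apply mul_left_cancel₀ hr0
      ring_nf at h ⊢
      linarith
  have e₂ : f * (r ^ 2 * a₁ * b₁ - r ^ 2 * b * a₂ + r * b * a₁
      + a * (r * b₁ - b ^ 3 + b)) = f₁ * r * b * (r * a₁ + a * (1 - ξ * b)) := by
    have h := congrArg₂ (· - ·) h3 h2
    rcases hξ with rfl | rfl
    all_goals
      field_simp at h
      ring_nf at h ⊢
      linarith
  have hprod : f * b * (a * (r ^ 2 * (a₁ * b₁ - b * a₂) + a * (b - b ^ 3))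
      + ξ * (r ^ 2 * a * a₂ + r ^ 2 * a₁ ^ 2 + a ^ 2 * (b ^ 2 - 1))) = 0 := by
    rcases hξ with rfl | rfl
    · linear_combination -(1 - b) * a * e₂ + r * (r * a₁ + a * (1 - b)) * e₁
    · linear_combination (1 + b) * a * e₂ - r * (r * a₁ + a * (1 + b)) * e₁
  exact (mul_eq_zero.mp hprod).resolve_left (mul_ne_zero hF0 hB0)
end

section
/- Let I ⊆ (0,∞) be an open interval, let A : I → ℝ be twice differentiable and positive, B : I → ℝ differentiable and positive, F : I → ℝ differentiable with F(r) ≠ 0 for all r ∈ I, and 𝔣 : I → ℝ. If the complex-tetrad vacuum f(T) field equations (E1), (E2), (E3) hold at every r ∈ I, then for all r ∈ I one has r²A(r)A''(r) + r²A'(r)² + A(r)²(B(r)² − 1) = 0, i.e. B(r)² = (A(r)² − r²A(r)A''(r) − r²A'(r)²)/A(r)². -/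
/-- In `f(T)` gravity with the complex spherically symmetric tetrad, the vacuum field
equations (E1)–(E3) imply `r²AA'' + r²A'² + A²(B² − 1) = 0`, i.e.
`B² = (A² − r²AA'' − r²A'²)/A²`. -/
theorem complex_tetrad_fT_B_relation
    (I : Set ℝ) (hI : ∃ p q : ℝ, I = Set.Ioo p q) (hIpos : I ⊆ Set.Ioi (0 : ℝ))
    (A B F 𝔣 : ℝ → ℝ)
    (hAdiff : ∀ r ∈ I, DifferentiableAt ℝ A r)
    (hAdiff2 : ∀ r ∈ I, DifferentiableAt ℝ (deriv A) r)
    (hApos : ∀ r ∈ I, 0 < A r)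
    (hBdiff : ∀ r ∈ I, DifferentiableAt ℝ B r)
    (hBpos : ∀ r ∈ I, 0 < B r)
    (hFdiff : ∀ r ∈ I, DifferentiableAt ℝ F r)
    (hFne : ∀ r ∈ I, F r ≠ 0)
    (hE1 : ∀ r ∈ I,
      -𝔣 r / 2
        + 2 * F r * (r * B r * deriv A r + A r * (B r - r * deriv B r))
            / (r ^ 2 * A r * (B r) ^ 3)
        + 2 * deriv F r / (r * (B r) ^ 2) = 0)
    (hE2 : ∀ r ∈ I,
      𝔣 r / 2 - 2 * F r * (2 * r * deriv A r + A r) / (r ^ 2 * A r * (B r) ^ 2) = 0)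
    (hE3 : ∀ r ∈ I,
      𝔣 r / 2
        + F r * (r * (r * deriv A r * deriv B r
              - B r * (r * deriv (deriv A) r + 3 * deriv A r))
            - A r * (-(r * deriv B r) + (B r) ^ 3 + B r)) / (r ^ 2 * A r * (B r) ^ 3)
        - (r * deriv A r + A r) * deriv F r / (r * A r * (B r) ^ 2) = 0) :
    ∀ r ∈ I,
      r ^ 2 * A r * deriv (deriv A) r + r ^ 2 * (deriv A r) ^ 2
          + (A r) ^ 2 * ((B r) ^ 2 - 1) = 0 ∧
      (B r) ^ 2 = ((A r) ^ 2 - r ^ 2 * A r * deriv (deriv A) r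
          - r ^ 2 * (deriv A r) ^ 2) / (A r) ^ 2 := by
  intro r hr
  have hr0 : r ≠ 0 := ne_of_gt (hIpos hr)
  have hA := (hApos r hr).ne'
  have hB := (hBpos r hr).ne'
  have hF := hFne r hr
  have h1 := hE1 r hr
  have h2 := hE2 r hr
  have h3 := hE3 r hr
  generalize deriv (deriv A) r = c at *
  generalize deriv A r = a at *
  generalize deriv B r = b at *
  generalize deriv F r = g at *
  generalize A r = A₀ at *
  generalize B r = B₀ at *
  generalize F r = F₀ at *
  have hf : 𝔣 r = 2 * (2 * F₀ * (2 * r * a + A₀) / (r ^ 2 * A₀ * B₀ ^ 2)) := by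
    linear_combination 2 * h2
  rw [hf] at h1 h3
  have hF' : g * A₀ * B₀ = F₀ * (a * B₀ + A₀ * b) := by
    have h : 2 * (g * A₀ * B₀ - F₀ * (a * B₀ + A₀ * b)) / (r * A₀ * B₀ ^ 3) = 0 := by
      rw [← h1]
      field_simp
      ring
    have hd : r * A₀ * B₀ ^ 3 ≠ 0 := by positivity
    have := (div_eq_zero_iff.mp h).resolve_right hd
    linarith
  have hg : g = F₀ * (a * B₀ + A₀ * b) / (A₀ * B₀) := by
    rw [eq_div_iff (mul_ne_zero hA hB)]
    linarith
  have key : r ^ 2 * A₀ * c + r ^ 2 * a ^ 2 + A₀ ^ 2 * (B₀ ^ 2 - 1) = 0 := by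
    have h : F₀ * (r ^ 2 * A₀ * c + r ^ 2 * a ^ 2 + A₀ ^ 2 * (B₀ ^ 2 - 1))
        / (r ^ 2 * A₀ ^ 2 * B₀ ^ 2) = 0 := by
      rw [← neg_eq_zero, ← h3, hg]
      field_simp
      ring
    have hd : r ^ 2 * A₀ ^ 2 * B₀ ^ 2 ≠ 0 := by positivity
    exact (mul_eq_zero.mp ((div_eq_zero_iff.mp h).resolve_right hd)).resolve_left hF
  refine ⟨key, ?_⟩
  rw [eq_div_iff (pow_ne_zero 2 hA)]
  linear_combination key
end

section
/- Let I ⊆ (0,∞) be an open interval and A : I → ℝ twice differentiable and positive. If A(r)² − r²A(r)A''(r) − r²A'(r)² = 1 for all r ∈ I (which is exactly the condition B = 1/A in the complex-tetrad relation B² = (A² − r²AA'' − r²A'²)/A²), then there exist constants M, c ∈ ℝ such that A(r)² = 1 − 2M/r + c·r² for all r ∈ I; i.e. the only Schwarzschild-like solutions with g_rr = −1/g_tt are Schwarzschild–de Sitter. -/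
/-- If a positive, twice differentiable `A` on an open interval `I ⊆ (0,∞)` satisfies
`A² − r²AA'' − r²A'² = 1` (the condition `B = 1/A` in the complex-tetrad relation),
then `A² = 1 − 2M/r + c·r²` for some constants `M, c`: Schwarzschild–de Sitter. -/
theorem complex_tetrad_schwarzschild_like_is_SdS
    (I : Set ℝ) (hI : ∃ p q : ℝ, I = Set.Ioo p q) (hIpos : I ⊆ Set.Ioi (0 : ℝ))
    (A : ℝ → ℝ)
    (hAdiff : ∀ r ∈ I, DifferentiableAt ℝ A r)
    (hAdiff2 : ∀ r ∈ I, DifferentiableAt ℝ (deriv A) r)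
    (hApos : ∀ r ∈ I, 0 < A r)
    (hode : ∀ r ∈ I,
      (A r) ^ 2 - r ^ 2 * A r * deriv (deriv A) r - r ^ 2 * (deriv A r) ^ 2 = 1) :
    ∃ M c : ℝ, ∀ r ∈ I, (A r) ^ 2 = 1 - 2 * M / r + c * r ^ 2 := by
  obtain ⟨p, q, rfl⟩ := hI
  have hF : ∀ r ∈ Set.Ioo p q, HasDerivAt
      (fun x => (x * (2 * A x * deriv A x) + ((A x) ^ 2 - 1)) / x ^ 2) 0 r := by
    intro r hr
    have hr0 : r ≠ 0 := ne_of_gt (hIpos hr)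
    have hA := (hAdiff r hr).hasDerivAt
    have hA' := (hAdiff2 r hr).hasDerivAt
    refine ((((hasDerivAt_id' r).mul ((hA.const_mul 2).mul hA')).add
      ((hA.pow 2).sub_const 1)).div ((hasDerivAt_id' r).pow 2) (pow_ne_zero 2 hr0)).congr_deriv ?_
    rw [div_eq_zero_iff]
    left
    simp only [Pi.add_apply, Pi.mul_apply, Pi.pow_apply]
    push_cast
    linear_combination (-2 * r) * hode r hr
  have hG : ∀ r ∈ Set.Ioo p q, HasDerivAt
      (fun x => x * (2 * ((A x) ^ 2 - 1) - x * (2 * A x * deriv A x))) 0 r := by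
    intro r hr
    have hA := (hAdiff r hr).hasDerivAt
    have hA' := (hAdiff2 r hr).hasDerivAt
    refine ((hasDerivAt_id' r).mul ((((hA.pow 2).sub_const 1).const_mul 2).sub
      ((hasDerivAt_id' r).mul ((hA.const_mul 2).mul hA')))).congr_deriv ?_
    simp only [Pi.sub_apply, Pi.mul_apply, Pi.pow_apply]
    push_cast
    linear_combination 2 * hode r hr
  obtain ⟨a, ha⟩ := isOpen_Ioo.exists_is_const_of_deriv_eq_zero isPreconnected_Ioo
    (fun r hr => (hF r hr).differentiableAt.differentiableWithinAt) fun r hr => (hF r hr).deriv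
  obtain ⟨b, hb⟩ := isOpen_Ioo.exists_is_const_of_deriv_eq_zero isPreconnected_Ioo
    (fun r hr => (hG r hr).differentiableAt.differentiableWithinAt) fun r hr => (hG r hr).deriv
  refine ⟨-b / 6, a / 3, fun r hr => ?_⟩
  have hr0 : r ≠ 0 := ne_of_gt (hIpos hr)
  rw [← ha r hr, ← hb r hr]
  field_simp
  ring
end

section
/- Let c, M ∈ ℝ and let I ⊆ (0,∞) be an open interval on which u(r) := 1 − 2M/r + c·r² > 0; set A = √u and define B by B² = (A² − r²AA'' − r²A'²)/A². Then: (i) A² − r²AA'' − r²A'² = 1 on I, so B = 1/A, and the torsion scalar T(r) = (2/(r²B²A))·((B²+1)A + 2rA') equals 4/r² + 6c on I; (ii) if f : (6c, ∞) → ℝ is differentiable and satisfies (2/r² − T(r))·f'(T(r)) + f(T(r))/2 = 0 for all r ∈ (0,∞), where T(r) = 4/r² + 6c, then there exists a constant C with f(s) = C·(s + 6c) for all s > 6c. Thus the unique f(T) Lagrangian admitting the Schwarzschild–de Sitter solution with g_rr = −1/g_tt is linear in T, i.e. TEGR plus a cosmological constant. -/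
open Set Filter Topology

/-- Away from the singular point `a`, solutions of `(x - a) f' = f` on a convex open set are
linear. -/
theorem exists_eq_mul_sub_of_sub_mul_deriv_eq {f : ℝ → ℝ} {a : ℝ} {S : Set ℝ}
    (hS : IsOpen S) (hconv : Convex ℝ S) (ha : a ∉ S)
    (hf : ∀ x ∈ S, DifferentiableAt ℝ f x) (hode : ∀ x ∈ S, (x - a) * deriv f x = f x) :
    ∃ C : ℝ, ∀ x ∈ S, f x = C * (x - a) := by
  have hne : ∀ x ∈ S, x - a ≠ 0 := fun x hx h => ha (by rwa [← sub_eq_zero.mp h])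
  have hg : ∀ x ∈ S, HasDerivAt (fun y => f y / (y - a)) 0 x := by
    intro x hx
    have h := (hf x hx).hasDerivAt.div ((hasDerivAt_id x).sub_const a) (hne x hx)
    refine h.congr_deriv ?_
    rw [id_eq, mul_comm, hode x hx]
    simp
  obtain ⟨C, hC⟩ := hS.exists_is_const_of_deriv_eq_zero hconv.isPreconnected
    (fun x hx => (hg x hx).differentiableAt.differentiableWithinAt)
    (fun x hx => (hg x hx).deriv)
  exact ⟨C, fun x hx => by rw [← hC x hx, div_mul_cancel₀ _ (hne x hx)]⟩

/-- A solution of `(x - a) f' = f` which is differentiable at the boundary point `a` has slope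
`f' a`. -/
theorem eq_deriv_mul_sub_of_sub_mul_deriv_eq {f : ℝ → ℝ} {a : ℝ} {S : Set ℝ}
    (hS : IsOpen S) (hconv : Convex ℝ S) (ha : a ∉ S) (hcl : a ∈ closure S)
    (hf : ∀ x ∈ S, DifferentiableAt ℝ f x) (hode : ∀ x ∈ S, (x - a) * deriv f x = f x)
    (hfa : DifferentiableAt ℝ f a) (hfa0 : f a = 0) :
    ∀ x ∈ S, f x = deriv f a * (x - a) := by
  obtain ⟨C, hC⟩ := exists_eq_mul_sub_of_sub_mul_deriv_eq hS hconv ha hf hode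
  have hsub : S ⊆ {a}ᶜ := fun x hx h => ha (by rwa [← mem_singleton_iff.mp h])
  have hlim : Tendsto (slope f a) (𝓝[S] a) (𝓝 (deriv f a)) :=
    (hasDerivAt_iff_tendsto_slope.mp hfa.hasDerivAt).mono_left (nhdsWithin_mono a hsub)
  have hconst : Tendsto (slope f a) (𝓝[S] a) (𝓝 C) := by
    refine tendsto_const_nhds.congr' ?_
    filter_upwards [self_mem_nhdsWithin] with x hx
    have hx' : x - a ≠ 0 := sub_ne_zero.mpr (hsub hx)
    rw [slope_def_field, hfa0, sub_zero, hC x hx, mul_div_cancel_right₀ _ hx']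
  have : (𝓝[S] a).NeBot := mem_closure_iff_nhdsWithin_neBot.mp hcl
  rw [tendsto_nhds_unique hlim hconst]
  exact hC

/-- Solutions of `(x - a) f' = f` on a half-line are linear, wherever the singular point lies. -/
theorem exists_eq_mul_sub_on_Ioi_of_sub_mul_deriv_eq {f : ℝ → ℝ} {a b : ℝ}
    (hf : ∀ x ∈ Ioi b, DifferentiableAt ℝ f x)
    (hode : ∀ x ∈ Ioi b, (x - a) * deriv f x = f x) :
    ∃ C : ℝ, ∀ x ∈ Ioi b, f x = C * (x - a) := by
  rcases le_or_gt a b with hab | hab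
  · exact exists_eq_mul_sub_of_sub_mul_deriv_eq isOpen_Ioi (convex_Ioi b) (not_lt.mpr hab) hf hode
  · have hfa0 : f a = 0 := by simpa using (hode a hab).symm
    refine ⟨deriv f a, fun x hx => ?_⟩
    rcases lt_trichotomy x a with h | rfl | h
    · refine eq_deriv_mul_sub_of_sub_mul_deriv_eq (S := Ioo b a) isOpen_Ioo (convex_Ioo b a)
        (fun h => lt_irrefl a h.2) ?_ (fun y hy => hf y hy.1) (fun y hy => hode y hy.1)
        (hf a hab) hfa0 x ⟨hx, h⟩
      rw [closure_Ioo hab.ne]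
      exact right_mem_Icc.mpr hab.le
    · simpa using hfa0
    · refine eq_deriv_mul_sub_of_sub_mul_deriv_eq (S := Ioi a) isOpen_Ioi (convex_Ioi a)
        (lt_irrefl a) ?_ (fun y hy => hf y (hab.trans hy)) (fun y hy => hode y (hab.trans hy))
        (hf a hab) hfa0 x h
      rw [closure_Ioi]
      exact self_mem_Ici

/-- If `A = √u` with `u > 0` and `u' = v`, `v' = w`, then `A A' = v / 2` and
`A A'' + A'² = w / 2`. -/
theorem sqrt_mul_deriv_and_deriv_deriv {u v : ℝ → ℝ} {w r : ℝ}
    (hu : ∀ᶠ x in 𝓝 r, 0 < u x ∧ HasDerivAt u (v x) x) (hv : HasDerivAt v w r) :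
    √(u r) * deriv (fun x => √(u x)) r = v r / 2 ∧
    √(u r) * deriv (deriv fun x => √(u x)) r + deriv (fun x => √(u x)) r ^ 2 = w / 2 := by
  have hd : deriv (fun x => √(u x)) =ᶠ[𝓝 r] fun x => v x / (2 * √(u x)) := by
    filter_upwards [hu] with x hx
    exact (hx.2.sqrt hx.1.ne').deriv
  obtain ⟨hpos, hur⟩ := hu.self_of_nhds
  have hs : √(u r) ≠ 0 := (Real.sqrt_pos.mpr hpos).ne'
  have h2 := (hv.div ((hur.sqrt hpos.ne').const_mul 2) (mul_ne_zero two_ne_zero hs)).deriv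
  have h2' : deriv (deriv fun x => √(u x)) r = _ := hd.deriv_eq.trans h2
  rw [h2', hd.self_of_nhds]
  constructor
  · field_simp
  · field_simp
    ring


/-- For `A = √(1 − 2M/r + c r²)` one has `A² − r²AA'' − r²A'² = 1`, so `B = 1/A` and the
torsion scalar equals `4/r² + 6c`; moreover, any differentiable `f` on `(6c,∞)` solving
`(2/r² − T)f'(T) + f(T)/2 = 0` for all `r > 0` is linear: `f(s) = C(s + 6c)`. -/
theorem complex_tetrad_SdS_unique_fT_Lagrangian
    (c M : ℝ) (I : Set ℝ) (hI : ∃ p q : ℝ, I = Set.Ioo p q) (hIpos : I ⊆ Set.Ioi (0 : ℝ))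
    (u A B : ℝ → ℝ)
    (hu : ∀ r, u r = 1 - 2 * M / r + c * r ^ 2)
    (hupos : ∀ r ∈ I, 0 < u r)
    (hA : ∀ r, A r = Real.sqrt (u r))
    (hBpos : ∀ r ∈ I, 0 < B r)
    (hB : ∀ r ∈ I,
      (B r) ^ 2 = ((A r) ^ 2 - r ^ 2 * A r * deriv (deriv A) r
          - r ^ 2 * (deriv A r) ^ 2) / (A r) ^ 2) :
    (∀ r ∈ I,
      (A r) ^ 2 - r ^ 2 * A r * deriv (deriv A) r - r ^ 2 * (deriv A r) ^ 2 = 1 ∧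
      B r = 1 / A r ∧
      (2 / (r ^ 2 * (B r) ^ 2 * A r)) * (((B r) ^ 2 + 1) * A r + 2 * r * deriv A r)
        = 4 / r ^ 2 + 6 * c) ∧
    ∀ f : ℝ → ℝ,
      (∀ s ∈ Set.Ioi (6 * c), DifferentiableAt ℝ f s) →
      (∀ r ∈ Set.Ioi (0 : ℝ),
        (2 / r ^ 2 - (4 / r ^ 2 + 6 * c)) * deriv f (4 / r ^ 2 + 6 * c)
          + f (4 / r ^ 2 + 6 * c) / 2 = 0) →
      ∃ C : ℝ, ∀ s ∈ Set.Ioi (6 * c), f s = C * (s + 6 * c) := by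
  constructor
  · intro r hr
    have hr0 : r ≠ 0 := (hIpos hr).ne'
    have hIopen : IsOpen I := by
      obtain ⟨p, q, rfl⟩ := hI
      exact isOpen_Ioo
    have hder : ∀ x ∈ I, HasDerivAt u (2 * M / x ^ 2 + 2 * c * x) x := by
      intro x hx
      have hx0 : x ≠ 0 := (hIpos hx).ne'
      rw [funext hu]
      have h := (((hasDerivAt_inv hx0).const_mul (2 * M)).const_sub 1).add
        ((hasDerivAt_pow 2 x).const_mul c)
      refine h.congr_deriv ?_
      field_simp
      ring
    have hder2 : HasDerivAt (fun x : ℝ => 2 * M / x ^ 2 + 2 * c * x)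
        (-(4 * M) / r ^ 3 + 2 * c) r := by
      have h := (((hasDerivAt_pow 2 r).inv (pow_ne_zero 2 hr0)).const_mul (2 * M)).add
        ((hasDerivAt_id r).const_mul (2 * c))
      refine h.congr_deriv ?_
      field_simp
      ring
    obtain ⟨h1, h2⟩ := sqrt_mul_deriv_and_deriv_deriv
      (by filter_upwards [hIopen.mem_nhds hr] with x hx using ⟨hupos x hx, hder x hx⟩) hder2
    rw [← funext hA, ← hA] at h1 h2
    have hApos : 0 < A r := by
      rw [hA]
      exact Real.sqrt_pos.mpr (hupos r hr)
    have hAsq : A r ^ 2 = 1 - 2 * M / r + c * r ^ 2 := by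
      rw [hA, Real.sq_sqrt (hupos r hr).le, hu]
    have hone : (A r) ^ 2 - r ^ 2 * A r * deriv (deriv A) r - r ^ 2 * (deriv A r) ^ 2 = 1 := by
      have : (A r) ^ 2 - r ^ 2 * A r * deriv (deriv A) r - r ^ 2 * (deriv A r) ^ 2
          = A r ^ 2 - r ^ 2 * (A r * deriv (deriv A) r + deriv A r ^ 2) := by ring
      rw [this, h2, hAsq]
      field_simp
      ring
    have hBA : B r = 1 / A r := by
      have h := hB r hr
      rw [hone, ← one_div_pow] at h
      exact (pow_left_inj₀ (hBpos r hr).le (by positivity) two_ne_zero).mp h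
    refine ⟨hone, hBA, ?_⟩
    have hT : (2 / (r ^ 2 * (B r) ^ 2 * A r)) * (((B r) ^ 2 + 1) * A r + 2 * r * deriv A r)
        = 2 / r ^ 2 * (1 + A r ^ 2 + 2 * r * (A r * deriv A r)) := by
      rw [hBA]
      field_simp
    rw [hT, h1, hAsq]
    field_simp
    ring
  · intro f hf hode
    obtain ⟨C, hC⟩ := exists_eq_mul_sub_on_Ioi_of_sub_mul_deriv_eq (a := -(6 * c)) hf (by
      intro s hs
      have hs' : 0 < s - 6 * c := sub_pos.mpr hs
      have h := hode (2 / √(s - 6 * c)) (div_pos two_pos (Real.sqrt_pos.mpr hs'))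
      have hsq : (2 / √(s - 6 * c)) ^ 2 = 4 / (s - 6 * c) := by
        rw [div_pow, Real.sq_sqrt hs'.le]
        norm_num
      have h4 : 4 / (4 / (s - 6 * c)) + 6 * c = s := by
        field_simp
        ring
      have h2 : 2 / (4 / (s - 6 * c)) = (s - 6 * c) / 2 := by
        field_simp
        norm_num
      rw [hsq, h4, h2] at h
      linarith)
    exact ⟨C, fun s hs => by rw [hC s hs, sub_neg_eq_add]⟩
end

section
/- Let b ∈ ℝ with 9 − 8b > 0 and let A : (0,∞) → ℝ be twice differentiable and positive with r²A''(r)/A(r) + r²A'(r)²/A(r)² + b − 1 = 0 for all r > 0 (the equation obtained from the complex-tetrad relation B² = (A² − r²AA'' − r²A'²)/A² by imposing B(r) = b constant). Then there exist constants c₁, c₂ such that A(r)² = c₁·r^{(1+√(9−8b))/2} + c₂·r^{(1−√(9−8b))/2} for all r > 0; equivalently, when c₁, c₂ are suitably signed, A(r) = a₂·r^{(1−√(9−8b))/4}·√(a₁ + r^{√(9−8b)}). -/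
open Set in
/-- Solutions of `r * f' = p * f` on `(0, ∞)` are multiples of `r ^ p`. -/
theorem eq_mul_rpow_of_hasDerivAt {f f' : ℝ → ℝ} {p : ℝ}
    (hf : ∀ r ∈ Ioi (0 : ℝ), HasDerivAt f (f' r) r)
    (h : ∀ r ∈ Ioi (0 : ℝ), r * f' r = p * f r) :
    ∀ r ∈ Ioi (0 : ℝ), f r = f 1 * r ^ p := by
  have hg : ∀ r ∈ Ioi (0 : ℝ), HasDerivAt (fun x => f x * x ^ (-p)) 0 r := by
    intro r hr
    have hr0 : r ≠ 0 := ne_of_gt hr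
    refine ((hf r hr).mul (Real.hasDerivAt_rpow_const (p := -p) (Or.inl hr0))).congr_deriv ?_
    rw [Real.rpow_sub_one hr0]
    have := h r hr
    field_simp
    linear_combination r ^ (-p) * this
  intro r hr
  have hc := isOpen_Ioi.is_const_of_deriv_eq_zero isPreconnected_Ioi
    (fun x hx => (hg x hx).differentiableAt.differentiableWithinAt)
    (fun x hx => (hg x hx).deriv) hr (mem_Ioi.2 one_pos)
  have hrp : r ^ p ≠ 0 := (Real.rpow_pos_of_pos hr p).ne'
  simp only [Real.rpow_neg (le_of_lt hr), Real.one_rpow, mul_one] at hc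
  rw [← hc, inv_mul_cancel_right₀ hrp]

open Set in
/-- Solutions of the Euler equation `r ^ 2 * u'' + p * q * u = 0` on `(0, ∞)`, where `p + q = 1`
and `p ≠ q`, are linear combinations of `r ^ p` and `r ^ q`. -/
theorem exists_eq_rpow_add_rpow_of_euler {u u' u'' : ℝ → ℝ} {p q : ℝ}
    (hpq : p + q = 1) (hne : p ≠ q)
    (hu : ∀ r ∈ Ioi (0 : ℝ), HasDerivAt u (u' r) r)
    (hu' : ∀ r ∈ Ioi (0 : ℝ), HasDerivAt u' (u'' r) r)
    (h : ∀ r ∈ Ioi (0 : ℝ), r ^ 2 * u'' r + p * q * u r = 0) :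
    ∃ c₁ c₂ : ℝ, ∀ r ∈ Ioi (0 : ℝ), u r = c₁ * r ^ p + c₂ * r ^ q := by
  have key : ∀ s t : ℝ, s + t = 1 → s * t = p * q → ∀ r ∈ Ioi (0 : ℝ),
      r * u' r - t * u r = (1 * u' 1 - t * u 1) * r ^ s := by
    intro s t hst hmul
    refine eq_mul_rpow_of_hasDerivAt (f := fun r => r * u' r - t * u r)
      (fun r hr => ((hasDerivAt_id r).mul (hu' r hr)).sub ((hu r hr).const_mul t)) ?_
    intro r hr
    simp only [id]
    linear_combination h r hr + (-(r * u' r)) * hst + u r * hmul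
  have hne' : p - q ≠ 0 := sub_ne_zero.2 hne
  refine ⟨(1 * u' 1 - q * u 1) / (p - q), -(1 * u' 1 - p * u 1) / (p - q), fun r hr => ?_⟩
  have h₁ := key p q hpq rfl r hr
  have h₂ := key q p (by linarith) (mul_comm q p) r hr
  field_simp
  linear_combination h₁ - h₂

/-- Solutions of `r²A''/A + r²(A'/A)² + b − 1 = 0` on `(0,∞)` (the complex-tetrad relation
with `B = b` constant, `9 − 8b > 0`) satisfy
`A² = c₁ r^((1+√(9−8b))/2) + c₂ r^((1−√(9−8b))/2)`. -/
theorem complex_tetrad_constant_B_solution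
    (b : ℝ) (hb : 0 < 9 - 8 * b) (A : ℝ → ℝ)
    (hAdiff : ∀ r ∈ Set.Ioi (0 : ℝ), DifferentiableAt ℝ A r)
    (hAdiff2 : ∀ r ∈ Set.Ioi (0 : ℝ), DifferentiableAt ℝ (deriv A) r)
    (hApos : ∀ r ∈ Set.Ioi (0 : ℝ), 0 < A r)
    (hode : ∀ r ∈ Set.Ioi (0 : ℝ),
      r ^ 2 * deriv (deriv A) r / A r + r ^ 2 * (deriv A r) ^ 2 / (A r) ^ 2 + b - 1 = 0) :
    ∃ c₁ c₂ : ℝ, ∀ r ∈ Set.Ioi (0 : ℝ),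
      (A r) ^ 2 = c₁ * r ^ ((1 + Real.sqrt (9 - 8 * b)) / 2)
        + c₂ * r ^ ((1 - Real.sqrt (9 - 8 * b)) / 2) := by
  have hsq : √(9 - 8 * b) ^ 2 = 9 - 8 * b := Real.sq_sqrt hb.le
  have hpos : 0 < √(9 - 8 * b) := Real.sqrt_pos.2 hb
  refine exists_eq_rpow_add_rpow_of_euler (u := fun r => A r ^ 2)
    (u' := fun r => 2 * (A r * deriv A r))
    (u'' := fun r => 2 * (deriv A r * deriv A r + A r * deriv (deriv A) r))
    (by ring) (by intro h; linarith) ?_ ?_ ?_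
  · intro r hr
    exact ((hAdiff r hr).hasDerivAt.pow 2).congr_deriv (by push_cast; ring)
  · intro r hr
    exact ((hAdiff r hr).hasDerivAt.mul (hAdiff2 r hr).hasDerivAt).const_mul 2
  · intro r hr
    have hA : A r ≠ 0 := (hApos r hr).ne'
    have h := hode r hr
    field_simp at h
    linear_combination 2 * h - A r ^ 2 / 4 * hsq
end

section
/- Let M, Q ∈ ℝ and let I ⊆ (0,∞) be an open interval on which r² − 2Mr + Q > 0 and r² ≠ 2Q. With A(r) = √(1 − 2M/r + Q/r²) and B defined by the complex-tetrad relation B² = (A² − r²AA'' − r²A'²)/A², one has for all r ∈ I: B(r)² = (r² − 2Q)/(r² − 2Mr + Q), and the torsion scalar T(r) = (2/(r²B²A))·((B²+1)A + 2rA') equals (4r² − 6Q)/(r⁴ − 2Qr²). -/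
theorem one_sub_two_mul_div_add_div_sq_eq {M Q r : ℝ} (hr : r ≠ 0) :
    1 - 2 * M / r + Q / r ^ 2 = (r ^ 2 - 2 * M * r + Q) / r ^ 2 := by
  field_simp

/-- The first derivative of `√(1 − 2M/r + Q/r²)`. -/
theorem hasDerivAt_sqrt_one_sub_div_add_div_sq {M Q r : ℝ} (hr : r ≠ 0)
    (hpos : 0 < 1 - 2 * M / r + Q / r ^ 2) :
    HasDerivAt (fun x : ℝ => √(1 - 2 * M / x + Q / x ^ 2))
      ((M / r ^ 2 - Q / r ^ 3) / √(1 - 2 * M / r + Q / r ^ 2)) r := by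
  have h := ((((hasDerivAt_const r (2 * M)).div (hasDerivAt_id r) hr).const_sub 1).add
    ((hasDerivAt_const r Q).div (hasDerivAt_pow 2 r) (pow_ne_zero 2 hr))).sqrt hpos.ne'
  refine h.congr_deriv ?_
  have hs := (Real.sqrt_pos.mpr hpos).ne'
  simp only [Pi.add_apply, Pi.div_apply, id_eq]
  generalize √(1 - 2 * M / r + Q / r ^ 2) = s at hs ⊢
  field_simp
  ring

/-- For the Reissner–Nordström-like ansatz `A = √(1 − 2M/r + Q/r²)` with the complex-tetrad
relation `B² = (A² − r²AA'' − r²A'²)/A²`, one gets `B² = (r² − 2Q)/(r² − 2Mr + Q)` and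
torsion scalar `T = (4r² − 6Q)/(r⁴ − 2Qr²)`. -/
theorem complex_tetrad_RN_like_solution
    (M Q : ℝ) (I : Set ℝ) (hI : ∃ p q : ℝ, I = Set.Ioo p q) (hIpos : I ⊆ Set.Ioi (0 : ℝ))
    (hpos : ∀ r ∈ I, 0 < r ^ 2 - 2 * M * r + Q)
    (hne : ∀ r ∈ I, r ^ 2 ≠ 2 * Q)
    (A B : ℝ → ℝ)
    (hA : ∀ r, A r = Real.sqrt (1 - 2 * M / r + Q / r ^ 2))
    (hB : ∀ r ∈ I,
      (B r) ^ 2 = ((A r) ^ 2 - r ^ 2 * A r * deriv (deriv A) r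
          - r ^ 2 * (deriv A r) ^ 2) / (A r) ^ 2) :
    ∀ r ∈ I,
      (B r) ^ 2 = (r ^ 2 - 2 * Q) / (r ^ 2 - 2 * M * r + Q) ∧
      (2 / (r ^ 2 * (B r) ^ 2 * A r)) * (((B r) ^ 2 + 1) * A r + 2 * r * deriv A r)
        = (4 * r ^ 2 - 6 * Q) / (r ^ 4 - 2 * Q * r ^ 2) := by
  obtain ⟨p, q, hIpq⟩ := hI
  have hIopen : IsOpen I := hIpq ▸ isOpen_Ioo
  obtain rfl : A = fun x => √(1 - 2 * M / x + Q / x ^ 2) := funext hA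
  have hne0 : ∀ x ∈ I, x ≠ 0 := fun x hx => (hIpos hx).ne'
  have hN : ∀ x ∈ I, 0 < 1 - 2 * M / x + Q / x ^ 2 := fun x hx => by
    rw [one_sub_two_mul_div_add_div_sq_eq (hne0 x hx)]
    exact div_pos (hpos x hx) (pow_pos (hIpos hx) 2)
  have hderiv := fun x hx => hasDerivAt_sqrt_one_sub_div_add_div_sq (hne0 x hx) (hN x hx)
  intro r hr
  have hr0 := hne0 r hr
  have hD := (hpos r hr).ne'
  have hE : r ^ 2 - 2 * Q ≠ 0 := sub_ne_zero.mpr (hne r hr)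
  have hs := (Real.sqrt_pos.mpr (hN r hr)).ne'
  have hsq := Real.sq_sqrt (hN r hr).le
  have hnum : HasDerivAt (fun x : ℝ => M / x ^ 2 - Q / x ^ 3)
      (-2 * M / r ^ 3 + 3 * Q / r ^ 4) r := by
    refine (((hasDerivAt_const r M).div (hasDerivAt_pow 2 r) (pow_ne_zero 2 hr0)).sub
      ((hasDerivAt_const r Q).div (hasDerivAt_pow 3 r) (pow_ne_zero 3 hr0))).congr_deriv ?_
    field_simp
    ring
  have hderiv2 := ((hnum.div (hderiv r hr) hs).congr_of_eventuallyEq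
    (Filter.eventuallyEq_of_mem (hIopen.mem_nhds hr) fun x hx => (hderiv x hx).deriv)).deriv
  have hBr := hB r hr
  rw [hderiv2, (hderiv r hr).deriv] at hBr
  rw [(hderiv r hr).deriv]
  beta_reduce at hBr ⊢
  generalize √(1 - 2 * M / r + Q / r ^ 2) = s at hs hsq hBr ⊢
  rw [one_sub_two_mul_div_add_div_sq_eq hr0] at hsq
  have hB2 : B r ^ 2 = (r ^ 2 - 2 * Q) / (r ^ 2 - 2 * M * r + Q) := by
    have hcancel : s ^ 2 - r ^ 2 * s * (((-2 * M / r ^ 3 + 3 * Q / r ^ 4) * s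
        - (M / r ^ 2 - Q / r ^ 3) * ((M / r ^ 2 - Q / r ^ 3) / s)) / s ^ 2)
        - r ^ 2 * ((M / r ^ 2 - Q / r ^ 3) / s) ^ 2
        = s ^ 2 - r ^ 2 * (-2 * M / r ^ 3 + 3 * Q / r ^ 4) := by
      field_simp
      ring
    rw [hBr, hcancel, hsq]
    field_simp
    ring
  refine ⟨hB2, ?_⟩
  have hcancel : 2 / (r ^ 2 * B r ^ 2 * s) *
      ((B r ^ 2 + 1) * s + 2 * r * ((M / r ^ 2 - Q / r ^ 3) / s))
      = 2 / (r ^ 2 * B r ^ 2) * (B r ^ 2 + 1 + 2 * r * (M / r ^ 2 - Q / r ^ 3) / s ^ 2) := by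
    field_simp
  have hden : r ^ 4 - 2 * Q * r ^ 2 = r ^ 2 * (r ^ 2 - 2 * Q) := by ring
  rw [hcancel, hB2, hsq, hden]
  generalize hDeq : r ^ 2 - 2 * M * r + Q = D at hD ⊢
  field_simp
  rw [← hDeq]
  ring
end

section
/- Let λ > 0, a₀ ∈ ℝ, a₁ ≠ 0. Define g(r) = √λ·(a₀λ + r) − 2·arctan(√λ·r/2) and let I ⊆ (0,∞) be an open interval on which g > 0; set u(r) = A(r)² = a₁²·g(r)/r. Then for all r ∈ I: (i) u(r) − r²u''(r)/2 = a₁²·λ^{5/2}·r⁴/(4 + λr²)² > 0, so B defined by B² = (u − r²u''/2)/u (the complex-tetrad relation B² = (A² − r²AA'' − r²A'²)/A²) satisfies A²B² = a₁²λ^{5/2}r⁴/(4 + λr²)²; (ii) the torsion scalar T(r) = (4u + 2ru' − r²u'')/(r²(u − r²u''/2)) equals (8 + 4λr²)/(λr⁴), independently of a₀ and a₁. In particular, for a₁² = 1/√λ one gets A·B·r² = λr⁴/(λr² + 4), so the tetrad determinant h = λr⁴ sinθ/(λr² + 4) is nonsingular for all r > 0. -/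
theorem hasDerivAt_bornInfeld_profile (lam c x : ℝ) (hlam : 0 < lam) :
    HasDerivAt (fun r => Real.sqrt lam * (c + r) - 2 * Real.arctan (Real.sqrt lam * r / 2))
      (Real.sqrt lam * lam * x ^ 2 / (4 + lam * x ^ 2)) x := by
  have hs : Real.sqrt lam ^ 2 = lam := Real.sq_sqrt hlam.le
  have h₁ : HasDerivAt (fun r : ℝ => Real.sqrt lam * (c + r)) (Real.sqrt lam * 1) x :=
    ((hasDerivAt_id x).const_add c).const_mul _
  have h₂ : HasDerivAt (fun r : ℝ => Real.sqrt lam * r / 2) (Real.sqrt lam * 1 / 2) x :=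
    ((hasDerivAt_id x).const_mul _).div_const 2
  refine (h₁.sub (h₂.arctan.const_mul 2)).congr_deriv ?_
  have hden : 1 + (Real.sqrt lam * x / 2) ^ 2 = (4 + lam * x ^ 2) / 4 := by
    rw [div_pow, mul_pow, hs]; ring
  have : 4 + lam * x ^ 2 ≠ 0 := by positivity
  rw [hden]
  field_simp
  ring

theorem hasDerivAt_bornInfeld_profile_deriv (lam x : ℝ) (hlam : 0 < lam) :
    HasDerivAt (fun r => Real.sqrt lam * lam * r ^ 2 / (4 + lam * r ^ 2))
      (8 * Real.sqrt lam * lam * x / (4 + lam * x ^ 2) ^ 2) x := by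
  have hne : 4 + lam * x ^ 2 ≠ 0 := by positivity
  have hsq : HasDerivAt (fun r : ℝ => r ^ 2) (2 * x) x := by
    simpa using hasDerivAt_pow 2 x
  refine ((hsq.const_mul (Real.sqrt lam * lam)).div
    ((hsq.const_mul lam).const_add 4) hne).congr_deriv ?_
  ring

theorem HasDerivAt.const_mul_div_self {f : ℝ → ℝ} {f' x : ℝ} (a : ℝ) (hf : HasDerivAt f f' x)
    (hx : x ≠ 0) :
    HasDerivAt (fun r => a * f r / r) (a * (f' / x - f x / x ^ 2)) x := by
  refine ((hf.const_mul a).div (hasDerivAt_id x) hx).congr_deriv ?_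
  simp only [id]
  field_simp

theorem deriv_deriv_const_mul_div_self {f f₁ : ℝ → ℝ} {f₂ x : ℝ} (a : ℝ)
    (hf : ∀ y, HasDerivAt f (f₁ y) y) (hf₁ : HasDerivAt f₁ f₂ x) (hx : x ≠ 0) :
    deriv (deriv fun r => a * f r / r) x
      = a * (f₂ / x - 2 * f₁ x / x ^ 2 + 2 * f x / x ^ 3) := by
  have heq : deriv (fun r => a * f r / r)
      =ᶠ[nhds x] fun y => a * (f₁ y / y - f y / y ^ 2) := by
    filter_upwards [isOpen_ne.mem_nhds hx] with y hy
    exact ((hf y).const_mul_div_self a hy).deriv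
  have hsq : HasDerivAt (fun r : ℝ => r ^ 2) (2 * x) x := by
    simpa using hasDerivAt_pow 2 x
  rw [heq.deriv_eq]
  refine HasDerivAt.deriv ?_
  refine (((hf₁.div (hasDerivAt_id x) hx).sub
    ((hf x).div hsq (pow_ne_zero 2 hx))).const_mul a).congr_deriv ?_
  simp only [id]
  field_simp
  ring

/-- For the Born–Infeld metric function `u = A² = a₁² g(r)/r` with
`g(r) = √λ(a₀λ + r) − 2 arctan(√λ r/2)`, one has
`u − r²u''/2 = a₁² λ^{5/2} r⁴/(4 + λr²)² > 0` (so `A²B² = a₁² λ^{5/2} r⁴/(4 + λr²)²` for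
`B² = (u − r²u''/2)/u`), the torsion scalar equals `(8 + 4λr²)/(λr⁴)` independently of
`a₀, a₁`, and for `a₁² = 1/√λ` one gets `(A B r²)² = (λr⁴/(λr² + 4))²`. -/
theorem born_infeld_metric_torsion_scalar
    (lam a₀ a₁ : ℝ) (hlam : 0 < lam) (ha₁ : a₁ ≠ 0)
    (g u B : ℝ → ℝ)
    (hg : ∀ r, g r = Real.sqrt lam * (a₀ * lam + r)
        - 2 * Real.arctan (Real.sqrt lam * r / 2))
    (I : Set ℝ) (hI : ∃ p q : ℝ, I = Set.Ioo p q) (hIpos : I ⊆ Set.Ioi (0 : ℝ))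
    (hgpos : ∀ r ∈ I, 0 < g r)
    (hu : ∀ r, u r = a₁ ^ 2 * g r / r)
    (hB : ∀ r ∈ I, (B r) ^ 2 = (u r - r ^ 2 * deriv (deriv u) r / 2) / u r) :
    ∀ r ∈ I,
      (u r - r ^ 2 * deriv (deriv u) r / 2
          = a₁ ^ 2 * (lam ^ 2 * Real.sqrt lam) * r ^ 4 / (4 + lam * r ^ 2) ^ 2 ∧
        0 < a₁ ^ 2 * (lam ^ 2 * Real.sqrt lam) * r ^ 4 / (4 + lam * r ^ 2) ^ 2 ∧
        u r * (B r) ^ 2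
          = a₁ ^ 2 * (lam ^ 2 * Real.sqrt lam) * r ^ 4 / (4 + lam * r ^ 2) ^ 2) ∧
      (4 * u r + 2 * r * deriv u r - r ^ 2 * deriv (deriv u) r)
          / (r ^ 2 * (u r - r ^ 2 * deriv (deriv u) r / 2))
        = (8 + 4 * lam * r ^ 2) / (lam * r ^ 4) ∧
      (a₁ ^ 2 = 1 / Real.sqrt lam →
        u r * (B r) ^ 2 * r ^ 4 = (lam * r ^ 4 / (lam * r ^ 2 + 4)) ^ 2) := by
  intro r hr
  have hr0 : 0 < r := hIpos hr
  have hne : r ≠ 0 := hr0.ne'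
  have hgr : 0 < g r := hgpos r hr
  have hs : 0 < Real.sqrt lam := Real.sqrt_pos.2 hlam
  have hd : 4 + lam * r ^ 2 ≠ 0 := by positivity
  have hg₁ : ∀ x, HasDerivAt g (Real.sqrt lam * lam * x ^ 2 / (4 + lam * x ^ 2)) x := by
    rw [funext hg]
    exact fun x => hasDerivAt_bornInfeld_profile lam (a₀ * lam) x hlam
  have hu₁ := ((hg₁ r).const_mul_div_self (a₁ ^ 2) hne).deriv
  have hu₂ := deriv_deriv_const_mul_div_self (a₁ ^ 2) hg₁
    (hasDerivAt_bornInfeld_profile_deriv lam r hlam) hne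
  rw [← funext hu] at hu₁ hu₂
  have hpos : 0 < u r := by rw [hu]; positivity
  have hi : u r - r ^ 2 * deriv (deriv u) r / 2
      = a₁ ^ 2 * (lam ^ 2 * Real.sqrt lam) * r ^ 4 / (4 + lam * r ^ 2) ^ 2 := by
    rw [hu₂, hu]
    field_simp
    ring
  have hAB : u r * (B r) ^ 2
      = a₁ ^ 2 * (lam ^ 2 * Real.sqrt lam) * r ^ 4 / (4 + lam * r ^ 2) ^ 2 := by
    rw [hB r hr, hi, mul_div_cancel₀ _ hpos.ne']
  refine ⟨⟨hi, by positivity, hAB⟩, ?_, fun ha => ?_⟩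
  · have hnum : 4 * u r + 2 * r * deriv u r - r ^ 2 * deriv (deriv u) r
        = a₁ ^ 2 * (lam * Real.sqrt lam) * r ^ 2 * (8 + 4 * lam * r ^ 2)
          / (4 + lam * r ^ 2) ^ 2 := by
      rw [hu₂, hu₁, hu]
      field_simp
      ring
    rw [hnum, hi]
    field_simp
  · rw [hAB, ha, add_comm (lam * r ^ 2)]
    field_simp
end

section
/- Let λ > 0 and define the Born–Infeld Lagrangian f(s) = λ(√(1 + 2s/λ) − 1) and T(r) = (8 + 4λr²)/(λr⁴). Then for every r > 0 one has f(T(r)) = 4/r² and f'(T(r)) = λr²/(λr² + 4), and the scalar field equation (2/r² − T(r))·f'(T(r)) + f(T(r))/2 = 0 holds identically on (0,∞). -/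
/-- The Born–Infeld Lagrangian `f(s) = λ(√(1 + 2s/λ) − 1)` with torsion scalar
`T(r) = (8 + 4λr²)/(λr⁴)` satisfies `f(T(r)) = 4/r²`, `f'(T(r)) = λr²/(λr² + 4)`, and the
scalar field equation `(2/r² − T)f'(T) + f(T)/2 = 0` identically on `(0,∞)`. -/
theorem born_infeld_scalar_field_equation
    (lam : ℝ) (hlam : 0 < lam) (f T : ℝ → ℝ)
    (hf : ∀ s, f s = lam * (Real.sqrt (1 + 2 * s / lam) - 1))
    (hT : ∀ r, T r = (8 + 4 * lam * r ^ 2) / (lam * r ^ 4)) :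
    ∀ r : ℝ, 0 < r →
      f (T r) = 4 / r ^ 2 ∧
      deriv f (T r) = lam * r ^ 2 / (lam * r ^ 2 + 4) ∧
      (2 / r ^ 2 - T r) * deriv f (T r) + f (T r) / 2 = 0 := by
  intro r hr
  have hne : lam ≠ 0 := hlam.ne'
  have hr0 : r ≠ 0 := hr.ne'
  have hpos : 0 < lam * r ^ 2 + 4 := by positivity
  have hsq : 1 + 2 * T r / lam = ((lam * r ^ 2 + 4) / (lam * r ^ 2)) ^ 2 := by
    rw [hT]
    field_simp
    ring
  have hsqrt : Real.sqrt (1 + 2 * T r / lam) = (lam * r ^ 2 + 4) / (lam * r ^ 2) := by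
    rw [hsq]
    exact Real.sqrt_sq (by positivity)
  have hfT : f (T r) = 4 / r ^ 2 := by
    rw [hf, hsqrt]
    field_simp
    ring
  have hderiv : deriv f (T r) = lam * r ^ 2 / (lam * r ^ 2 + 4) := by
    have hin : HasDerivAt (fun s : ℝ => 1 + 2 * s / lam) (2 * 1 / lam) (T r) :=
      (((hasDerivAt_id' (T r)).const_mul 2).div_const lam).const_add 1
    have hin_ne : 1 + 2 * T r / lam ≠ 0 := by
      rw [hsq]
      positivity
    have hd := ((hin.sqrt hin_ne).sub_const 1).const_mul lam
    rw [funext hf, hd.deriv, hsqrt]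
    field_simp
  refine ⟨hfT, hderiv, ?_⟩
  rw [hderiv, hfT, hT]
  field_simp
  ring
end

section
/- Let M > 0 and λ > 0, and define h_λ(r) = √λ·(r − 2M) − 2·arctan(√λ·r/2), so that the Born–Infeld metric function with a₀ = −2M/λ and a₁² = 1/√λ is A²(r) = h_λ(r)/(√λ·r). Then: (i) lim_{r→∞} A²(r) = 1 (asymptotic flatness); (ii) h_λ is strictly increasing on (0,∞), with h_λ(2M) < 0 and h_λ(2M + π/√λ) > 0, so h_λ has a unique zero r_h(λ) in (0,∞), and 2M < r_h(λ) < 2M + π/√λ (the horizon lies beyond the Schwarzschild radius); (iii) lim_{λ→∞} √λ·(r_h(λ) − 2M) = π. -/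
open Filter

/-- The function `t ↦ t - arctan t` is strictly increasing on `[0, ∞)`. -/
theorem strictMonoOn_sub_arctan :
    StrictMonoOn (fun t : ℝ => t - Real.arctan t) (Set.Ici 0) := by
  refine strictMonoOn_of_deriv_pos (convex_Ici 0)
    (continuous_id.sub Real.continuous_arctan).continuousOn fun t ht => ?_
  rw [interior_Ici, Set.mem_Ioi] at ht
  rw [((hasDerivAt_id' t).fun_sub (Real.hasDerivAt_arctan t)).deriv, sub_pos,
    div_lt_one (by positivity)]
  exact lt_add_of_pos_right 1 (by positivity)

/-- For the Born–Infeld black hole with `h_λ(r) = √λ(r − 2M) − 2 arctan(√λ r/2)` and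
`A² = h_λ(r)/(√λ r)`: (i) `A² → 1` as `r → ∞`; (ii) `h_λ` is strictly increasing on
`(0,∞)`, negative at `2M` and positive at `2M + π/√λ`, so it has a unique positive zero
`r_h(λ)` with `2M < r_h(λ) < 2M + π/√λ`; (iii) `√λ(r_h(λ) − 2M) → π` as `λ → ∞`. -/
theorem born_infeld_horizon
    (M : ℝ) (hM : 0 < M) (H : ℝ → ℝ → ℝ)
    (hH : ∀ lam r, H lam r = Real.sqrt lam * (r - 2 * M)
        - 2 * Real.arctan (Real.sqrt lam * r / 2)) :
    (∀ lam : ℝ, 0 < lam →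
      Tendsto (fun r => H lam r / (Real.sqrt lam * r)) atTop (nhds 1)) ∧
    (∀ lam : ℝ, 0 < lam →
      StrictMonoOn (H lam) (Set.Ioi 0) ∧
      H lam (2 * M) < 0 ∧
      0 < H lam (2 * M + Real.pi / Real.sqrt lam) ∧
      (∃! r : ℝ, 0 < r ∧ H lam r = 0) ∧
      (∀ r : ℝ, 0 < r → H lam r = 0 →
        2 * M < r ∧ r < 2 * M + Real.pi / Real.sqrt lam)) ∧
    (∀ rh : ℝ → ℝ, (∀ lam : ℝ, 0 < lam → 0 < rh lam ∧ H lam (rh lam) = 0) →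
      Tendsto (fun lam => Real.sqrt lam * (rh lam - 2 * M)) atTop (nhds Real.pi)) := by
  have hs : ∀ lam : ℝ, 0 < lam → 0 < Real.sqrt lam := fun _ => Real.sqrt_pos.2
  have hmono : ∀ lam : ℝ, 0 < lam → StrictMonoOn (H lam) (Set.Ioi 0) := by
    intro lam hlam x hx y hy hxy
    have h0 := hs lam hlam
    rw [Set.mem_Ioi] at hx hy
    have h := strictMonoOn_sub_arctan
      (show Real.sqrt lam * x / 2 ∈ Set.Ici 0 from by rw [Set.mem_Ici]; positivity)
      (show Real.sqrt lam * y / 2 ∈ Set.Ici 0 from by rw [Set.mem_Ici]; positivity)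
      (by gcongr)
    simp only at h
    rw [hH, hH]
    linarith
  have hneg : ∀ lam : ℝ, 0 < lam → H lam (2 * M) < 0 := by
    intro lam hlam
    have h0 := hs lam hlam
    have h : 0 < Real.arctan (Real.sqrt lam * (2 * M) / 2) :=
      Real.arctan_pos.2 (by positivity)
    rw [hH, sub_self, mul_zero]
    linarith
  have hpos : ∀ lam : ℝ, 0 < lam → 0 < H lam (2 * M + Real.pi / Real.sqrt lam) := by
    intro lam hlam
    have h0 := hs lam hlam
    have h := Real.arctan_lt_pi_div_two
      (Real.sqrt lam * (2 * M + Real.pi / Real.sqrt lam) / 2)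
    rw [hH, add_sub_cancel_left, mul_div_cancel₀ _ h0.ne']
    linarith
  have hloc : ∀ lam : ℝ, 0 < lam → ∀ r : ℝ, 0 < r → H lam r = 0 →
      2 * M < r ∧ r < 2 * M + Real.pi / Real.sqrt lam := by
    intro lam hlam r hr hr0
    have h0 := hs lam hlam
    have hM2 : 2 * M ∈ Set.Ioi (0 : ℝ) := by rw [Set.mem_Ioi]; positivity
    have hMp : 2 * M + Real.pi / Real.sqrt lam ∈ Set.Ioi (0 : ℝ) := by
      rw [Set.mem_Ioi]; have := Real.pi_pos; positivity
    exact ⟨((hmono lam hlam).lt_iff_lt hM2 hr).1 (hr0 ▸ hneg lam hlam),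
      ((hmono lam hlam).lt_iff_lt hr hMp).1 (hr0 ▸ hpos lam hlam)⟩
  refine ⟨fun lam hlam => ?_, fun lam hlam =>
    ⟨hmono lam hlam, hneg lam hlam, hpos lam hlam, ?_, hloc lam hlam⟩, fun rh hrh => ?_⟩
  · have h0 := hs lam hlam
    have hlin : Tendsto (fun r => Real.sqrt lam * r) atTop atTop :=
      tendsto_id.const_mul_atTop h0
    have harctan : Tendsto (fun r => Real.arctan (Real.sqrt lam * r / 2)) atTop
        (nhds (Real.pi / 2)) :=
      (tendsto_nhds_of_tendsto_nhdsWithin Real.tendsto_arctan_atTop).comp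
        (hlin.atTop_div_const two_pos)
    have hlim := ((tendsto_const_nhds (x := (1 : ℝ))).sub
      ((tendsto_const_nhds (x := 2 * M)).div_atTop tendsto_id)).sub
      ((harctan.const_mul 2).div_atTop hlin)
    rw [sub_zero, sub_zero] at hlim
    refine hlim.congr' ?_
    filter_upwards [eventually_gt_atTop 0] with r hr
    simp only [id]
    rw [hH]
    field_simp
  · have hcont : Continuous (H lam) := by
      have : H lam = fun r => Real.sqrt lam * (r - 2 * M)
          - 2 * Real.arctan (Real.sqrt lam * r / 2) := funext (hH lam)
      rw [this]
      fun_prop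
    have h0 := hs lam hlam
    have hle : 2 * M ≤ 2 * M + Real.pi / Real.sqrt lam :=
      le_add_of_nonneg_right (div_nonneg Real.pi_pos.le h0.le)
    obtain ⟨r, hr, hr0⟩ := intermediate_value_Icc hle hcont.continuousOn
      ⟨(hneg lam hlam).le, (hpos lam hlam).le⟩
    have hr' : 0 < r := lt_of_lt_of_le (by positivity) hr.1
    exact ⟨r, ⟨hr', hr0⟩, fun y hy =>
      (hmono lam hlam).injOn hy.1 hr' (hy.2.trans hr0.symm)⟩
  · have harg : Tendsto (fun lam => Real.sqrt lam * rh lam / 2) atTop atTop := by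
      refine tendsto_atTop_mono' _ ?_ (Real.tendsto_sqrt_atTop.atTop_mul_const hM)
      filter_upwards [eventually_gt_atTop 0] with lam hlam
      have h := (hloc lam hlam _ (hrh lam hlam).1 (hrh lam hlam).2).1
      have := mul_le_mul_of_nonneg_left h.le (hs lam hlam).le
      linarith
    have hlim := ((tendsto_nhds_of_tendsto_nhdsWithin Real.tendsto_arctan_atTop).comp
      harg).const_mul 2
    rw [mul_div_cancel₀ _ two_ne_zero] at hlim
    refine hlim.congr' ?_
    filter_upwards [eventually_gt_atTop 0] with lam hlam
    have h := (hrh lam hlam).2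
    rw [hH] at h
    exact (sub_eq_zero.1 h).symm
end

section
/- Let M ∈ ℝ and r > 0, and for λ > 0 set A²_λ(r) = (√λ·(r − 2M) − 2·arctan(√λ·r/2))/(√λ·r). Then lim_{λ→∞} λ·(A²_λ(r) − (1 − 2M/r) + π/(√λ·r)) = 4/r²; that is, the Born–Infeld metric function has the large-λ expansion A²_λ(r) = 1 − 2M/r − π/(√λ·r) + 4/(λr²) + o(1/λ). -/
open Filter

theorem tendsto_mul_arctan_inv_atTop :
    Tendsto (fun y : ℝ => y * Real.arctan y⁻¹) atTop (nhds 1) := by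
  have h := (hasDerivAt_iff_tendsto_slope_zero.mp (Real.hasDerivAt_arctan 0)).comp
    (tendsto_inv_atTop_nhdsGT_zero.mono_right (nhdsWithin_mono (0 : ℝ) fun _ hx => ne_of_gt hx))
  simpa [Function.comp_def] using h

/-- Large-`λ` expansion of the Born–Infeld metric function: with
`A²_λ(r) = (√λ(r − 2M) − 2 arctan(√λ r/2))/(√λ r)`,
`λ·(A²_λ(r) − (1 − 2M/r) + π/(√λ r)) → 4/r²` as `λ → ∞`. -/
theorem born_infeld_large_lambda_expansion (M r : ℝ) (hr : 0 < r) :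
    Tendsto (fun lam : ℝ =>
        lam * ((Real.sqrt lam * (r - 2 * M)
            - 2 * Real.arctan (Real.sqrt lam * r / 2)) / (Real.sqrt lam * r)
          - (1 - 2 * M / r) + Real.pi / (Real.sqrt lam * r)))
      atTop (nhds (4 / r ^ 2)) := by
  have hy : Tendsto (fun lam : ℝ => Real.sqrt lam * r / 2) atTop atTop :=
    (Real.tendsto_sqrt_atTop.atTop_mul_const hr).atTop_div_const two_pos
  have h := (tendsto_mul_arctan_inv_atTop.comp hy).const_mul (4 / r ^ 2)
  rw [mul_one] at h
  refine h.congr' ?_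
  filter_upwards [eventually_gt_atTop 0] with lam hlam
  have hs : 0 < Real.sqrt lam := Real.sqrt_pos.mpr hlam
  have hsq : lam = Real.sqrt lam ^ 2 := (Real.sq_sqrt hlam.le).symm
  simp only [Function.comp_apply]
  rw [Real.arctan_inv_of_pos (by positivity)]
  generalize Real.arctan (Real.sqrt lam * r / 2) = a
  generalize Real.sqrt lam = s at hs hsq
  subst hsq
  field_simp
  ring
end

section
/- Let M > 0, L ≠ 0, and let a, b : ℝ → ℝ be continuously differentiable in a neighbourhood of r₀ = 3M. For ε ∈ ℝ define A²(r,ε) = 1 − 2M/r + ε·a(r), B²(r,ε) = (1 − 2M/r)^{−1} + ε·b(r), and the null effective potential V(r,E,ε) = L²/(2r²B²(r,ε)) − E²/(2A²(r,ε)B²(r,ε)). Set r(ε) = 3M + ε·((9M²/2)·a'(3M) − 3M·a(3M)) and E(ε) = (L/(3√3·M))·(1 + ε·(3/2)·a(3M)). Then both ε ↦ V(r(ε), E(ε), ε) and ε ↦ (∂V/∂r)(r(ε), E(ε), ε) vanish to first order at ε = 0: each has value 0 and derivative 0 at ε = 0. Thus the perturbed spacetime has a circular photon orbit at r = 3M·(1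 + ε·(1/4)(6M·a'(3M) − 4a(3M))) with energy E = (L/(3√3 M))·(1 + ε·3a(3M)/2), to first order in ε. -/
/-- A function vanishing at `x` and differentiable there, times a function that is merely continuous
at `x`, is differentiable at `x`. -/
theorem HasDerivAt.mul_continuousAt_of_eq_zero {f g : ℝ → ℝ} {f' x : ℝ} (hf : HasDerivAt f f' x)
    (hx : f x = 0) (hg : ContinuousAt g x) :
    HasDerivAt (fun y => f y * g y) (f' * g x) x := by
  rw [hasDerivAt_iff_tendsto_slope] at hf ⊢
  refine (hf.mul (hg.tendsto.mono_left nhdsWithin_le_nhds)).congr fun y => ?_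
  simp only [slope_def_field, hx]
  ring

/-- The radial derivative of the potential `(L² / (2r²) - E² / (2α(r))) / β(r)`. -/
theorem hasDerivAt_nullPotential {α β : ℝ → ℝ} {α' β' r : ℝ} (L E : ℝ) (hr : r ≠ 0)
    (hα : HasDerivAt α α' r) (hβ : HasDerivAt β β' r) (hα0 : α r ≠ 0) (hβ0 : β r ≠ 0) :
    HasDerivAt (fun s => (L ^ 2 / (2 * s ^ 2) - E ^ 2 / (2 * α s)) * (β s)⁻¹)
      ((-L ^ 2 / r ^ 3 + E ^ 2 * α' / (2 * α r ^ 2)) * (β r)⁻¹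
        + (L ^ 2 / (2 * r ^ 2) - E ^ 2 / (2 * α r)) * (-β' / β r ^ 2)) r := by
  have h1 : HasDerivAt (fun s : ℝ => L ^ 2 / (2 * s ^ 2)) (-L ^ 2 / r ^ 3) r := by
    refine ((hasDerivAt_const r (L ^ 2)).fun_div (((hasDerivAt_id' r).fun_pow 2).const_mul 2)
      (by positivity)).congr_deriv ?_
    field_simp
    ring
  have h2 : HasDerivAt (fun s => E ^ 2 / (2 * α s)) (-(E ^ 2 * α') / (2 * α r ^ 2)) r := by
    refine ((hasDerivAt_const r (E ^ 2)).fun_div (hα.const_mul 2)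
      (mul_ne_zero two_ne_zero hα0)).congr_deriv ?_
    field_simp
    ring
  refine ((h1.fun_sub h2).fun_mul (hβ.fun_inv hβ0)).congr_deriv ?_
  ring

theorem hasDerivAt_one_sub_div (m : ℝ) {r : ℝ} (hr : r ≠ 0) :
    HasDerivAt (fun s => 1 - m / s) (m / r ^ 2) r := by
  refine (((hasDerivAt_const r m).fun_div (hasDerivAt_id' r) hr).const_sub 1).congr_deriv ?_
  ring


/-- First-order perturbed circular photon orbit: for the perturbed Schwarzschild metric
`A² = 1 − 2M/r + εa(r)`, `B² = (1 − 2M/r)⁻¹ + εb(r)` and the null effective potential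
`V = L²/(2r²B²) − E²/(2A²B²)`, the curves `r(ε) = 3M + ε((9M²/2)a'(3M) − 3Ma(3M))` and
`E(ε) = (L/(3√3 M))(1 + ε(3/2)a(3M))` make both `V` and `∂V/∂r` vanish to first order
in `ε` at `ε = 0`. -/
theorem perturbed_circular_photon_orbit
    (M L : ℝ) (hM : 0 < M) (hL : L ≠ 0) (a b : ℝ → ℝ)
    (ha : ContDiffAt ℝ 1 a (3 * M)) (hb : ContDiffAt ℝ 1 b (3 * M))
    (A2 B2 : ℝ → ℝ → ℝ) (V : ℝ → ℝ → ℝ → ℝ) (rε Eε : ℝ → ℝ)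
    (hA2 : ∀ r e, A2 r e = 1 - 2 * M / r + e * a r)
    (hB2 : ∀ r e, B2 r e = (1 - 2 * M / r)⁻¹ + e * b r)
    (hV : ∀ r E e, V r E e = L ^ 2 / (2 * r ^ 2 * B2 r e)
        - E ^ 2 / (2 * A2 r e * B2 r e))
    (hr : ∀ e, rε e = 3 * M + e * ((9 * M ^ 2 / 2) * deriv a (3 * M) - 3 * M * a (3 * M)))
    (hE : ∀ e, Eε e = (L / (3 * Real.sqrt 3 * M)) * (1 + e * (3 / 2) * a (3 * M))) :
    (fun e => V (rε e) (Eε e) e) 0 = 0 ∧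
    deriv (fun e => V (rε e) (Eε e) e) 0 = 0 ∧
    (fun e => deriv (fun r => V r (Eε e) e) (rε e)) 0 = 0 ∧
    deriv (fun e => deriv (fun r => V r (Eε e) e) (rε e)) 0 = 0 := by
  set a₀ := a (3 * M) with ha₀
  set a₁ := deriv a (3 * M) with ha₁
  set c := 9 * M ^ 2 / 2 * a₁ - 3 * M * a₀ with hc
  have hM0 : M ≠ 0 := hM.ne'
  have hr0 : rε 0 = 3 * M := by rw [hr]; ring
  have hf0 : 1 - 2 * M / (3 * M) = 1 / 3 := by field_simp; norm_num
  have hrd : HasDerivAt rε c 0 := by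
    rw [funext hr]
    simpa using ((hasDerivAt_id' (0 : ℝ)).mul_const c).const_add (3 * M)
  have hrc : ContinuousAt rε 0 := hrd.continuousAt
  have hE2 : ∀ e, Eε e ^ 2 = L ^ 2 / (27 * M ^ 2) * (1 + e * (3 / 2) * a₀) ^ 2 := by
    intro e
    rw [hE, mul_pow, div_pow, mul_pow, mul_pow, Real.sq_sqrt (by norm_num)]
    ring
  have hE2d : HasDerivAt (fun e => Eε e ^ 2) (L ^ 2 / (27 * M ^ 2) * (3 * a₀)) 0 := by
    rw [funext hE2]
    refine (((((((hasDerivAt_id' (0 : ℝ)).mul_const (3 / 2 : ℝ)).mul_const a₀).const_add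
      1).fun_pow 2).const_mul (L ^ 2 / (27 * M ^ 2)))).congr_deriv ?_
    ring
  have hE20 : Eε 0 ^ 2 = L ^ 2 / (27 * M ^ 2) := by rw [hE2]; ring
  have had : HasDerivAt a a₁ (rε 0) := by
    rw [hr0]; exact (ha.differentiableAt one_ne_zero).hasDerivAt
  have har : ContinuousAt (fun e => a (rε e)) 0 := had.continuousAt.comp hrc
  have hbr : ContinuousAt (fun e => b (rε e)) 0 :=
    ContinuousAt.comp (by rw [hr0]; exact hb.continuousAt) hrc
  have ha'r : ContinuousAt (fun e => deriv a (rε e)) 0 :=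
    ContinuousAt.comp (g := deriv a) (by rw [hr0]; exact (ha.derivWithin (m := 0) (by simp)).continuousAt) hrc
  have hb'r : ContinuousAt (fun e => deriv b (rε e)) 0 :=
    ContinuousAt.comp (g := deriv b) (by rw [hr0]; exact (hb.derivWithin (m := 0) (by simp)).continuousAt) hrc
  have hr0' : rε 0 ≠ 0 := by rw [hr0]; positivity
  have hfd : HasDerivAt (fun e => 1 - 2 * M / rε e) (2 / (9 * M) * c) 0 := by
    refine ((hasDerivAt_one_sub_div (2 * M) hr0').comp (0 : ℝ) hrd).congr_deriv ?_
    rw [hr0]; field_simp; ring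
  have hfr0 : 1 - 2 * M / rε 0 ≠ 0 := by rw [hr0, hf0]; norm_num
  have hA0 : A2 (rε 0) 0 = 1 / 3 := by rw [hA2, hr0, hf0]; ring
  have hB0 : B2 (rε 0) 0 = 3 := by rw [hB2, hr0, hf0]; norm_num
  have hAd : HasDerivAt (fun e => A2 (rε e) e) (2 / (9 * M) * c + a₀) 0 := by
    simp only [hA2]
    refine (hfd.fun_add
      ((hasDerivAt_id' (0 : ℝ)).mul_continuousAt_of_eq_zero rfl har)).congr_deriv ?_
    rw [hr0]; ring
  have hBc : ContinuousAt (fun e => B2 (rε e) e) 0 := by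
    simp only [hB2]
    exact (hfd.continuousAt.inv₀ hfr0).add (continuousAt_id.mul hbr)
  have hA0' : A2 (rε 0) 0 ≠ 0 := by rw [hA0]; norm_num
  have hB0' : B2 (rε 0) 0 ≠ 0 := by rw [hB0]; norm_num
  let α' : ℝ → ℝ := fun e => 2 * M / rε e ^ 2 + e * deriv a (rε e)
  let β' : ℝ → ℝ := fun e =>
    -(2 * M / rε e ^ 2) / (1 - 2 * M / rε e) ^ 2 + e * deriv b (rε e)
  let W : ℝ → ℝ := fun e => L ^ 2 / (2 * rε e ^ 2) - Eε e ^ 2 / (2 * A2 (rε e) e)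
  let W' : ℝ → ℝ := fun e => -L ^ 2 / rε e ^ 3 + Eε e ^ 2 * α' e / (2 * A2 (rε e) e ^ 2)
  have hα'0 : α' 0 = 2 / (9 * M) := by
    simp only [α', hr0]; field_simp; norm_num
  have hα'd : HasDerivAt α' (-4 / (27 * M ^ 2) * c + a₁) 0 := by
    refine (((hasDerivAt_const (0 : ℝ) (2 * M)).fun_div (hrd.fun_pow 2)
      (pow_ne_zero 2 hr0')).fun_add
      ((hasDerivAt_id' (0 : ℝ)).mul_continuousAt_of_eq_zero rfl ha'r)).congr_deriv ?_
    rw [hr0, ← ha₁]; field_simp; ring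
  have hβ'c : ContinuousAt β' 0 :=
    (((continuousAt_const.div (hrc.pow 2) (pow_ne_zero 2 hr0')).neg).div
      (hfd.continuousAt.pow 2) (pow_ne_zero 2 hfr0)).add (continuousAt_id.mul hb'r)
  have hW0 : W 0 = 0 := by
    change L ^ 2 / (2 * rε 0 ^ 2) - Eε 0 ^ 2 / (2 * A2 (rε 0) 0) = 0
    rw [hA0, hE20, hr0]; field_simp; norm_num
  have hWd : HasDerivAt W 0 0 := by
    refine (((hasDerivAt_const (0 : ℝ) (L ^ 2)).fun_div ((hrd.fun_pow 2).const_mul 2)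
      (mul_ne_zero two_ne_zero (pow_ne_zero 2 hr0'))).fun_sub
      (hE2d.fun_div (hAd.const_mul 2) (mul_ne_zero two_ne_zero hA0'))).congr_deriv ?_
    rw [hA0, hE20, hr0]; field_simp; ring
  have hW'0 : W' 0 = 0 := by
    change -L ^ 2 / rε 0 ^ 3 + Eε 0 ^ 2 * α' 0 / (2 * A2 (rε 0) 0 ^ 2) = 0
    rw [hA0, hE20, hα'0, hr0]
    field_simp; norm_num
  have hW'd : HasDerivAt W' 0 0 := by
    refine (((hasDerivAt_const (0 : ℝ) (-L ^ 2)).fun_div (hrd.fun_pow 3)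
      (pow_ne_zero 3 hr0')).fun_add
      ((hE2d.fun_mul hα'd).fun_div ((hAd.fun_pow 2).const_mul 2)
        (mul_ne_zero two_ne_zero (pow_ne_zero 2 hA0')))).congr_deriv ?_
    rw [hA0, hE20, hr0, hα'0, hc]; field_simp; ring
  have hBi : ContinuousAt (fun e => (B2 (rε e) e)⁻¹) 0 := hBc.inv₀ hB0'
  have hVW : ∀ r E e, V r E e =
      (L ^ 2 / (2 * r ^ 2) - E ^ 2 / (2 * A2 r e)) * (B2 r e)⁻¹ := by
    intro r E e
    rw [hV, sub_mul, ← div_eq_mul_inv, ← div_eq_mul_inv, div_div, div_div]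
  have hVd : HasDerivAt (fun e => V (rε e) (Eε e) e) 0 0 := by
    simp only [hVW]
    simpa only [zero_mul] using hWd.mul_continuousAt_of_eq_zero hW0 hBi
  have hdiff : ∀ {g : ℝ → ℝ}, ContDiffAt ℝ 1 g (3 * M) →
      ∀ᶠ e in nhds 0, DifferentiableAt ℝ g (rε e) := by
    intro g hg
    refine hrc.eventually ?_
    rw [hr0]
    exact (hg.eventually (by simp)).mono fun _ h => h.differentiableAt one_ne_zero
  have hev : (fun e => deriv (fun r => V r (Eε e) e) (rε e)) =ᶠ[nhds 0]
      fun e => W' e * (B2 (rε e) e)⁻¹ + W e * (-β' e / B2 (rε e) e ^ 2) := by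
    filter_upwards [hdiff ha, hdiff hb, hrc.eventually_ne hr0', hfd.continuousAt.eventually_ne hfr0,
      hAd.continuousAt.eventually_ne hA0', hBc.eventually_ne hB0'] with e hae hbe hre hfe hAe hBe
    have hf := hasDerivAt_one_sub_div (2 * M) hre
    have hα : HasDerivAt (fun r => A2 r e) (α' e) (rε e) := by
      simp only [hA2]
      exact hf.fun_add (hae.hasDerivAt.const_mul e)
    have hβ : HasDerivAt (fun r => B2 r e) (β' e) (rε e) := by
      simp only [hB2]
      exact (hf.fun_inv hfe).fun_add (hbe.hasDerivAt.const_mul e)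
    simp only [hVW]
    exact (hasDerivAt_nullPotential L (Eε e) hre hα hβ hAe hBe).deriv
  have hGd : HasDerivAt (fun e => deriv (fun r => V r (Eε e) e) (rε e)) 0 0 := by
    refine HasDerivAt.congr_of_eventuallyEq ?_ hev
    simpa only [zero_mul, add_zero] using (hW'd.mul_continuousAt_of_eq_zero hW'0 hBi).fun_add
      (hWd.mul_continuousAt_of_eq_zero hW0 (hβ'c.fun_neg.div₀ (hBc.fun_pow 2) (pow_ne_zero 2 hB0')))
  refine ⟨?_, hVd.deriv, ?_, hGd.deriv⟩
  · change V (rε 0) (Eε 0) 0 = 0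
    rw [hVW]
    exact mul_eq_zero_of_left hW0 _
  · refine hev.eq_of_nhds.trans ?_
    rw [hW'0, hW0]
    ring
end

section
/- Let I ⊆ (0,∞) be an open interval and A : I → ℝ twice differentiable and positive; set B = 1/A. If for all r ∈ I the equation r·(B(r)(rA''(r) + A'(r)) − rA'(r)B'(r)) + A(r)·(rB'(r) + B(r)³ − B(r)) = 0 holds, then there exist constants M, c ∈ ℝ such that A(r)² = 1 − 2M/r + c·r² for all r ∈ I; i.e. the unique solution of f(T,B) = k₁T + F(B) gravity (with the complex tetrad) having g_rr = −1/g_tt is the Schwarzschild–de Sitter metric. -/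
/-- In `f(T,B) = k₁T + F(B)` gravity with the complex tetrad, the `F`-independent vacuum
equation `r(B(rA'' + A') − rA'B') + A(rB' + B³ − B) = 0` with `B = 1/A` forces the
Schwarzschild–de Sitter form `A² = 1 − 2M/r + c·r²`. -/
theorem fTB_complex_tetrad_schwarzschild_like_is_SdS
    (I : Set ℝ) (hI : ∃ p q : ℝ, I = Set.Ioo p q) (hIpos : I ⊆ Set.Ioi (0 : ℝ))
    (A : ℝ → ℝ)
    (hAdiff : ∀ r ∈ I, DifferentiableAt ℝ A r)
    (hAdiff2 : ∀ r ∈ I, DifferentiableAt ℝ (deriv A) r)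
    (hApos : ∀ r ∈ I, 0 < A r)
    (B : ℝ → ℝ) (hB : ∀ r, B r = 1 / A r)
    (hode : ∀ r ∈ I,
      r * (B r * (r * deriv (deriv A) r + deriv A r) - r * deriv A r * deriv B r)
        + A r * (r * deriv B r + (B r) ^ 3 - B r) = 0) :
    ∃ M c : ℝ, ∀ r ∈ I, (A r) ^ 2 = 1 - 2 * M / r + c * r ^ 2 := by
  obtain ⟨p, q, rfl⟩ := hI
  rcases (Set.Ioo p q).eq_empty_or_nonempty with hempty | ⟨x, hx⟩
  · exact ⟨0, 0, fun r hr => by simp [hempty] at hr⟩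
  have ode : ∀ r ∈ Set.Ioo p q,
      r ^ 2 * (A r * deriv (deriv A) r + deriv A r ^ 2) = A r ^ 2 - 1 := by
    intro r hr
    have hA : A r ≠ 0 := (hApos r hr).ne'
    have hBderiv : deriv B r = -deriv A r / A r ^ 2 := by
      have hBeq : B = fun s => (A s)⁻¹ := funext fun s => by rw [hB, one_div]
      rw [hBeq]
      exact ((hAdiff r hr).hasDerivAt.fun_inv hA).deriv
    have h := hode r hr
    rw [hBderiv, hB] at h
    field_simp at h
    linear_combination h
  have hF : ∀ r ∈ Set.Ioo p q, HasDerivAt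
      (fun s => (2 * s * (A s * deriv A s) + (A s ^ 2 - 1)) / (3 * s ^ 2)) 0 r := by
    intro r hr
    have hr0 : r ≠ 0 := (hIpos hr).ne'
    have h1 := (hAdiff r hr).hasDerivAt
    have h2 := (hAdiff2 r hr).hasDerivAt
    have h := ((((hasDerivAt_id' r).const_mul 2).fun_mul (h1.fun_mul h2)).fun_add
      ((h1.fun_pow 2).sub_const 1)).fun_div (((hasDerivAt_id' r).fun_pow 2).const_mul 3)
      (by positivity)
    refine h.congr_deriv ?_
    rw [div_eq_zero_iff]
    left
    push_cast
    linear_combination 6 * r * ode r hr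
  have hG : ∀ r ∈ Set.Ioo p q, HasDerivAt
      (fun s => s * (2 * (A s ^ 2 - 1) - 2 * s * (A s * deriv A s)) / 3) 0 r := by
    intro r hr
    have h1 := (hAdiff r hr).hasDerivAt
    have h2 := (hAdiff2 r hr).hasDerivAt
    have h := ((hasDerivAt_id' r).fun_mul ((((h1.fun_pow 2).sub_const 1).const_mul 2).fun_sub
      (((hasDerivAt_id' r).const_mul 2).fun_mul (h1.fun_mul h2)))).div_const 3
    refine h.congr_deriv ?_
    push_cast
    linear_combination -(2 / 3) * ode r hr
  have const : ∀ f : ℝ → ℝ, (∀ r ∈ Set.Ioo p q, HasDerivAt f 0 r) →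
      ∀ r ∈ Set.Ioo p q, f r = f x := fun f hf r hr =>
    isOpen_Ioo.is_const_of_deriv_eq_zero isPreconnected_Ioo
      (fun s hs => (hf s hs).differentiableAt.differentiableWithinAt)
      (fun s hs => (hf s hs).deriv) hr hx
  refine ⟨-(x * (2 * (A x ^ 2 - 1) - 2 * x * (A x * deriv A x)) / 3) / 2,
    (2 * x * (A x * deriv A x) + (A x ^ 2 - 1)) / (3 * x ^ 2), fun r hr => ?_⟩
  have hr0 : r ≠ 0 := (hIpos hr).ne'
  have hFr := const _ hF r hr
  have hGr := const _ hG r hr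
  beta_reduce at hFr hGr
  rw [← hFr, ← hGr]
  field_simp
  ring
end
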